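/- Let φ : ℝ^{n−1} → ℝ be differentiable with Lipschitz gradient, ν(x) = (∇φ(x), −1)/√(1+|∇φ(x)|²), η the standard normalized bump on ℝ^{n−1}, η_s(x) = s^{−(n−1)}η(x/s), and F(x,s) = (x,φ(x)) − s·(η_s * ν)(x) for s > 0. Then for every x ∈ ℝ^{n−1}, as s → 0⁺: (i) ∂_k F(x,s) → (e_k, ∂_kφ(x)) for each k = 1, …, n−1, where e_k is the k-th standard basis vector of ℝ^{n−1}; and (ii) ∂_s F(x,s) → −ν(x). In particular, if φ(0) = 0 and ∇φ(0) = 0, then DF(0,s) converges to the identity matrix as s → 0⁺. -/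

import Mathlib

open MeasureTheory Metric Set Filter
open scoped ENNReal NNReal Topology ContDiff

noncomputable section

abbrev Euc (n : ℕ) := EuclideanSpace ℝ (Fin n)

/-- The standard bump function `η(x) = C e^{1/(|x|²-1)}` for `|x| < 1`, `0` otherwise. -/
def bump (d : ℕ) (C : ℝ) (x : Euc d) : ℝ :=
  if ‖x‖ < 1 then C * Real.exp (1 / (‖x‖ ^ 2 - 1)) else 0

/-- The rescaled mollifier `η_s(x) = s^{-d} η(x/s)`. -/
def bumpS (d : ℕ) (C : ℝ) (s : ℝ) (x : Euc d) : ℝ :=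
  (s ^ d)⁻¹ * bump d C (s⁻¹ • x)

/-- The downward-graph unit normal `ν(x) = (∇φ(x), −1)/√(1 + |∇φ(x)|²)`. -/
def normalVec {d : ℕ} (φ : Euc d → ℝ) (x : Euc d) : Euc d × ℝ :=
  (Real.sqrt (1 + ‖gradient φ x‖ ^ 2))⁻¹ • (gradient φ x, (-1 : ℝ))

/-- The componentwise convolution `(η_s * ν)(x) = ∫ η_s(y) ν(x−y) dy`. -/
def convNormal {d : ℕ} (C : ℝ) (φ : Euc d → ℝ) (s : ℝ) (x : Euc d) : Euc d × ℝ :=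
  ∫ y : Euc d, bumpS d C s y • normalVec φ (x - y)

/-- `F(x,s) = (x, φ(x)) − s (η_s * ν)(x)`. -/
def Fmap {d : ℕ} (C : ℝ) (φ : Euc d → ℝ) (p : Euc d × ℝ) : Euc d × ℝ :=
  ((p.1, φ p.1) : Euc d × ℝ) - p.2 • convNormal C φ p.2 p.1

/-- `G(x,s) = (x, φ(x)) + s (η_s * ν)(x)`. -/
def Gmap {d : ℕ} (C : ℝ) (φ : Euc d → ℝ) (p : Euc d × ℝ) : Euc d × ℝ :=
  ((p.1, φ p.1) : Euc d × ℝ) + p.2 • convNormal C φ p.2 p.1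

/-- The two-sided extension `F̃(x,s)`: `F(x,s)` for `s ≥ 0` (with `F̃(x,0) = (x,φ(x))`)
and `G(x,−s)` for `s < 0`. -/
def Ftil {d : ℕ} (C : ℝ) (φ : Euc d → ℝ) (p : Euc d × ℝ) : Euc d × ℝ :=
  if 0 ≤ p.2 then Fmap C φ p else Gmap C φ (p.1, -p.2)

lemma bump_eq_glue (d : ℕ) (C : ℝ) :
    bump d C = fun x => C * expNegInvGlue (1 - ‖x‖ ^ 2) := by
  funext x
  unfold bump expNegInvGlue
  by_cases h : ‖x‖ < 1
  · have h2 : ¬ (1 - ‖x‖ ^ 2 ≤ 0) := by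
      have := norm_nonneg x
      nlinarith
    rw [if_pos h, if_neg h2, one_div, ← inv_neg, neg_sub]
  · have h2 : 1 - ‖x‖ ^ 2 ≤ 0 := by
      push Not at h
      nlinarith
    rw [if_neg h, if_pos h2, mul_zero]

lemma bump_contDiff (d : ℕ) (C : ℝ) : ContDiff ℝ 1 (bump d C) := by
  rw [bump_eq_glue]
  exact contDiff_const.mul
    ((expNegInvGlue.contDiff (n := 1)).comp (contDiff_const.sub (contDiff_norm_sq ℝ)))

lemma bump_nonneg (d : ℕ) {C : ℝ} (hC : 0 < C) (x : Euc d) : 0 ≤ bump d C x := by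
  rw [bump_eq_glue]
  exact mul_nonneg hC.le (expNegInvGlue.nonneg _)

lemma bump_zero (d : ℕ) {C : ℝ} {x : Euc d} (h : 1 ≤ ‖x‖) : bump d C x = 0 := by
  simp [bump, not_lt.2 h]

lemma bump_compactSupport (d : ℕ) (C : ℝ) : HasCompactSupport (bump d C) :=
  HasCompactSupport.intro (isCompact_closedBall (0 : Euc d) 1) fun x hx => by
    apply bump_zero
    simp only [mem_closedBall, dist_zero_right, not_le] at hx
    exact hx.le

lemma sqrt_lip {d : ℕ} (v w : Euc d) :
    |Real.sqrt (1 + ‖v‖ ^ 2) - Real.sqrt (1 + ‖w‖ ^ 2)| ≤ ‖v - w‖ := by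
  have h0 : ∀ u : Euc d, 0 ≤ 1 + ‖u‖ ^ 2 := fun u => by positivity
  have hv := Real.sq_sqrt (h0 v)
  have hw := Real.sq_sqrt (h0 w)
  have hv1 : ‖v‖ ≤ Real.sqrt (1 + ‖v‖ ^ 2) := Real.le_sqrt_of_sq_le (by linarith)
  have hw1 : ‖w‖ ≤ Real.sqrt (1 + ‖w‖ ^ 2) := Real.le_sqrt_of_sq_le (by linarith)
  have hv2 : 1 ≤ Real.sqrt (1 + ‖v‖ ^ 2) := Real.le_sqrt_of_sq_le (by nlinarith [sq_nonneg ‖v‖])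
  have hw2 : 1 ≤ Real.sqrt (1 + ‖w‖ ^ 2) := Real.le_sqrt_of_sq_le (by nlinarith [sq_nonneg ‖w‖])
  set a := Real.sqrt (1 + ‖v‖ ^ 2)
  set b := Real.sqrt (1 + ‖w‖ ^ 2)
  have hab := abs_norm_sub_norm_le v w
  have hs : 0 < a + b := by linarith
  have key : |a - b| * (a + b) = |‖v‖ - ‖w‖| * (‖v‖ + ‖w‖) := by
    have e1 : |a - b| * (a + b) = |(a - b) * (a + b)| := by rw [abs_mul, abs_of_pos hs]
    have e2 : |‖v‖ - ‖w‖| * (‖v‖ + ‖w‖) = |(‖v‖ - ‖w‖) * (‖v‖ + ‖w‖)| := by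
      rw [abs_mul, abs_of_nonneg (add_nonneg (norm_nonneg v) (norm_nonneg w))]
    rw [e1, e2]
    congr 1
    nlinarith
  have : |a - b| * (a + b) ≤ ‖v - w‖ * (a + b) := by
    rw [key]
    gcongr
  exact le_of_mul_le_mul_right this hs

def nmap {d : ℕ} (v : Euc d) : Euc d × ℝ :=
  (Real.sqrt (1 + ‖v‖ ^ 2))⁻¹ • (v, (-1 : ℝ))

lemma nmap_lip {d : ℕ} (v w : Euc d) : ‖nmap v - nmap w‖ ≤ 2 * ‖v - w‖ := by
  have hl := sqrt_lip v w
  have hw1 : ‖w‖ ≤ Real.sqrt (1 + ‖w‖ ^ 2) := Real.le_sqrt_of_sq_le (by linarith)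
  have hv2 : 1 ≤ Real.sqrt (1 + ‖v‖ ^ 2) := Real.le_sqrt_of_sq_le (by nlinarith [sq_nonneg ‖v‖])
  have hw2 : 1 ≤ Real.sqrt (1 + ‖w‖ ^ 2) := Real.le_sqrt_of_sq_le (by nlinarith [sq_nonneg ‖w‖])
  unfold nmap
  set a := Real.sqrt (1 + ‖v‖ ^ 2)
  set b := Real.sqrt (1 + ‖w‖ ^ 2)
  have ha : 0 < a := by linarith
  have hb : 0 < b := by linarith
  have e : a⁻¹ • (v, (-1 : ℝ)) - b⁻¹ • (w, (-1 : ℝ))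
      = a⁻¹ • (v - w, (0 : ℝ)) + ((b - a) * a⁻¹) • (b⁻¹ • (w, (-1 : ℝ))) := by
    have h1 : (b - a) * a⁻¹ * b⁻¹ = a⁻¹ - b⁻¹ := by field_simp
    rw [smul_smul, h1]
    ext1
    · simp only [Prod.fst_sub, Prod.fst_add, Prod.smul_fst]
      module
    · simp
      ring
  have hn : ‖b⁻¹ • (w, (-1 : ℝ))‖ ≤ 1 := by
    rw [norm_smul, Real.norm_of_nonneg (by positivity), inv_mul_le_iff₀ hb, mul_one, Prod.norm_def]
    simpa using ⟨hw1, hw2⟩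
  have hai : a⁻¹ ≤ 1 := inv_le_one_of_one_le₀ hv2
  have hai0 : 0 ≤ a⁻¹ := by positivity
  rw [e]
  refine (norm_add_le _ _).trans ?_
  have t1 : ‖a⁻¹ • (v - w, (0 : ℝ))‖ ≤ ‖v - w‖ := by
    rw [norm_smul, Real.norm_of_nonneg hai0, Prod.norm_def]
    simp only [norm_zero, norm_nonneg, sup_of_le_left]
    exact mul_le_of_le_one_left (norm_nonneg _) hai
  have t2 : ‖((b - a) * a⁻¹) • (b⁻¹ • (w, (-1 : ℝ)))‖ ≤ ‖v - w‖ := by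
    rw [norm_smul, norm_mul, Real.norm_of_nonneg hai0, Real.norm_eq_abs, abs_sub_comm]
    calc |a - b| * a⁻¹ * ‖b⁻¹ • (w, (-1 : ℝ))‖ ≤ ‖v - w‖ * 1 * 1 := by gcongr
      _ = _ := by ring
  linarith

lemma normalVec_lip {d : ℕ} {φ : Euc d → ℝ} {K : ℝ≥0} (h : LipschitzWith K (gradient φ)) :
    LipschitzWith (2 * K) (normalVec φ) := by
  refine LipschitzWith.of_dist_le_mul fun x y => ?_
  rw [dist_eq_norm]
  refine (nmap_lip (gradient φ x) (gradient φ y)).trans ?_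
  have := h.dist_le_mul x y
  rw [dist_eq_norm] at this
  push_cast
  linarith

lemma convNormal_eq {d : ℕ} (C : ℝ) (φ : Euc d → ℝ) {s : ℝ} (hs : 0 < s) (x : Euc d) :
    convNormal C φ s x = ∫ z : Euc d, bump d C z • normalVec φ (x - s • z) := by
  have h := Measure.integral_comp_smul (volume : Measure (Euc d))
    (fun y => bump d C (s⁻¹ • y) • normalVec φ (x - y)) s
  simp only [smul_smul, inv_mul_cancel₀ hs.ne', one_smul] at h
  rw [h]
  unfold convNormal bumpS
  rw [abs_of_pos (by positivity), ← integral_smul]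
  simp [mul_smul]

lemma conv_lip {d : ℕ} {φ : Euc d → ℝ} {L : ℝ≥0} (h : LipschitzWith L (normalVec φ))
    {C : ℝ} (hC : 0 < C) (hnorm : ∫ x : Euc d, bump d C x = 1) (x x' : Euc d) (s s' : ℝ) :
    ‖(∫ z : Euc d, bump d C z • normalVec φ (x - s • z))
      - ∫ z : Euc d, bump d C z • normalVec φ (x' - s' • z)‖ ≤ L * (‖x - x'‖ + |s - s'|) := by
  have hI : ∀ (x : Euc d) (s : ℝ),
      Integrable (fun z : Euc d => bump d C z • normalVec φ (x - s • z)) := by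
    intro x s
    refine Continuous.integrable_of_hasCompactSupport ?_ ?_
    · exact (bump_contDiff d C).continuous.smul (h.continuous.comp (by fun_prop))
    · exact (bump_compactSupport d C).smul_right
  have hb : Integrable (bump d C) :=
    (bump_contDiff d C).continuous.integrable_of_hasCompactSupport (bump_compactSupport d C)
  rw [← integral_sub (hI _ _) (hI _ _)]
  have : ∫ z : Euc d, bump d C z * (L * (‖x - x'‖ + |s - s'|)) = L * (‖x - x'‖ + |s - s'|) := by
    rw [integral_mul_const, hnorm, one_mul]
  rw [← this]
  refine norm_integral_le_of_norm_le (hb.mul_const _) (Eventually.of_forall fun z => ?_)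
  rw [← smul_sub, norm_smul, Real.norm_of_nonneg (bump_nonneg d hC z)]
  rcases le_or_gt 1 ‖z‖ with hz | hz
  · simp [bump_zero d hz]
  · refine mul_le_mul_of_nonneg_left ?_ (bump_nonneg d hC z)
    refine (h.norm_sub_le _ _).trans ?_
    gcongr
    have e : x - s • z - (x' - s' • z) = (x - x') - (s - s') • z := by module
    rw [e]
    refine (norm_sub_le _ _).trans ?_
    rw [norm_smul, Real.norm_eq_abs]
    have := mul_le_of_le_one_right (abs_nonneg (s - s')) hz.le
    linarith

lemma conv_diff {d : ℕ} {φ : Euc d → ℝ} (h : Continuous (normalVec φ)) (C : ℝ)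
    (x : Euc d) {s : ℝ} (hs : 0 < s) :
    DifferentiableAt ℝ (fun p : Euc d × ℝ => convNormal C φ p.2 p.1) (x, s) := by
  have key : ContDiffOn ℝ (1 : ℕ∞) (fun q : ℝ × Euc d =>
      (convolution (normalVec φ) (bumpS d C q.1)
        (ContinuousLinearMap.lsmul ℝ ℝ (E := Euc d × ℝ)).flip volume) q.2)
      (Ioo 0 (2 * s) ×ˢ univ) := by
    refine contDiffOn_convolution_right_with_param _ (k := closedBall 0 (2 * s)) isOpen_Ioo
      (isCompact_closedBall _ _) ?_ h.locallyIntegrable ?_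
    · intro p y hp hy
      simp only [mem_closedBall, dist_zero_right, not_le] at hy
      unfold bumpS
      rw [bump_zero, mul_zero]
      rw [norm_smul, norm_inv, Real.norm_of_nonneg hp.1.le, le_inv_mul_iff₀ hp.1, mul_one]
      linarith [hp.2]
    · have hne : ∀ q ∈ Ioo (0 : ℝ) (2 * s) ×ˢ (univ : Set (Euc d)), q.1 ≠ 0 := 
        fun q hq => hq.1.1.ne'
      have hfst : ContDiffOn ℝ 1 (fun q : ℝ × Euc d => q.1) (Ioo 0 (2 * s) ×ˢ univ) :=
        contDiff_fst.contDiffOn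
      have hsnd : ContDiffOn ℝ 1 (fun q : ℝ × Euc d => q.2) (Ioo 0 (2 * s) ×ˢ univ) :=
        contDiff_snd.contDiffOn
      exact ((hfst.pow d).inv fun q hq => pow_ne_zero _ (hne q hq)).mul
        ((bump_contDiff d C).comp_contDiffOn ((hfst.inv hne).smul hsnd))
  have h1 : DifferentiableAt ℝ (fun q : ℝ × Euc d => convNormal C φ q.1 q.2) (s, x) := by
    have := (key.differentiableOn (by simp)).differentiableAt (x := (s, x))
      ((isOpen_Ioo.prod isOpen_univ).mem_nhds ⟨⟨hs, by linarith⟩, mem_univ _⟩)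
    have e : (fun q : ℝ × Euc d => convNormal C φ q.1 q.2) = fun q : ℝ × Euc d =>
      (convolution (normalVec φ) (bumpS d C q.1)
        (ContinuousLinearMap.lsmul ℝ ℝ (E := Euc d × ℝ)).flip volume) q.2 := by
      funext q
      rw [convolution_eq_swap]
      rfl
    rw [e]
    exact this
  exact DifferentiableAt.comp (x, s) (g := fun q : ℝ × Euc d => convNormal C φ q.1 q.2)
    (f := fun p : Euc d × ℝ => (p.2, p.1)) h1 (by fun_prop)

lemma main_tendsto (d : ℕ) (φ : Euc d → ℝ) (hφ : Differentiable ℝ φ)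
    (Kgrad : ℝ≥0) (hLip : LipschitzWith Kgrad (gradient φ))
    (C : ℝ) (hC : 0 < C) (hnorm : ∫ x : Euc d, bump d C x = 1) (x : Euc d) :
    Tendsto (fun s : ℝ => fderiv ℝ (Fmap C φ) (x, s)) (𝓝[>] 0)
      (𝓝 ((ContinuousLinearMap.fst ℝ (Euc d) ℝ).prod
          ((fderiv ℝ φ x).comp (ContinuousLinearMap.fst ℝ (Euc d) ℝ))
        - (ContinuousLinearMap.snd ℝ (Euc d) ℝ).smulRight (normalVec φ x))) := by
  have hν := normalVec_lip hLip
  set L := 2 * Kgrad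
  set A : Euc d × ℝ → Euc d × ℝ := fun p => convNormal C φ p.2 p.1 with hA
  have hAlip : ∀ (x x' : Euc d) (s s' : ℝ), 0 < s → 0 < s' →
      ‖A (x, s) - A (x', s')‖ ≤ L * (‖x - x'‖ + |s - s'|) := by
    intro x x' s s' hs hs'
    simp only [hA, convNormal_eq C φ hs, convNormal_eq C φ hs']
    exact conv_lip hν hC hnorm x x' s s'
  have hA0 : ∀ s : ℝ, 0 < s → ‖A (x, s) - normalVec φ x‖ ≤ L * s := by
    intro s hs
    have := conv_lip hν hC hnorm x x s 0
    simp only [hA, convNormal_eq C φ hs]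
    simpa [integral_smul_const, hnorm, abs_of_pos hs] using this
  have hbd : ∀ s : ℝ, 0 < s → ‖fderiv ℝ A (x, s)‖ ≤ 2 * L := by
    intro s hs
    refine norm_fderiv_le_of_lip' ℝ (by positivity) ?_
    have : ∀ᶠ p : Euc d × ℝ in 𝓝 (x, s), 0 < p.2 :=
      continuous_snd.continuousAt.eventually (lt_mem_nhds hs)
    filter_upwards [this] with p hp
    refine (hAlip p.1 x p.2 s hp hs).trans ?_
    have h1 : ‖p.1 - x‖ ≤ ‖p - (x, s)‖ := norm_fst_le (p - (x, s))
    have h2 : |p.2 - s| ≤ ‖p - (x, s)‖ := norm_snd_le (p - (x, s))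
    have : (0 : ℝ) ≤ L := L.2
    nlinarith
  have hform : ∀ s : ℝ, 0 < s → fderiv ℝ (Fmap C φ) (x, s) =
      (ContinuousLinearMap.fst ℝ (Euc d) ℝ).prod
          ((fderiv ℝ φ x).comp (ContinuousLinearMap.fst ℝ (Euc d) ℝ))
        - (s • fderiv ℝ A (x, s)
          + (ContinuousLinearMap.snd ℝ (Euc d) ℝ).smulRight (A (x, s))) := by
    intro s hs
    have hAd : HasFDerivAt A (fderiv ℝ A (x, s)) (x, s) :=
      (conv_diff hν.continuous C x hs).hasFDerivAt
    have h1 : HasFDerivAt (fun p : Euc d × ℝ => p.1) (ContinuousLinearMap.fst ℝ (Euc d) ℝ) (x, s) :=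
      hasFDerivAt_fst
    have h2 : HasFDerivAt (fun p : Euc d × ℝ => p.2) (ContinuousLinearMap.snd ℝ (Euc d) ℝ) (x, s) :=
      hasFDerivAt_snd
    have h3 : HasFDerivAt (fun p : Euc d × ℝ => φ p.1)
        ((fderiv ℝ φ x).comp (ContinuousLinearMap.fst ℝ (Euc d) ℝ)) (x, s) :=
      HasFDerivAt.comp (x, s) (hφ x).hasFDerivAt h1
    exact ((h1.prodMk h3).sub (h2.smul hAd)).fderiv
  have hs0 : Tendsto (fun s : ℝ => s) (𝓝[>] 0) (𝓝 0) := tendsto_nhdsWithin_of_tendsto_nhds tendsto_id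
  have T1 : Tendsto (fun s : ℝ => s • fderiv ℝ A (x, s)) (𝓝[>] 0) (𝓝 0) := by
    refine squeeze_zero_norm' (a := fun s : ℝ => s * (2 * L)) ?_ (by simpa using hs0.mul_const _)
    filter_upwards [self_mem_nhdsWithin] with s hs
    rw [norm_smul, Real.norm_of_nonneg (le_of_lt hs)]
    exact mul_le_mul_of_nonneg_left (hbd s hs) (le_of_lt hs)
  have T2 : Tendsto (fun s : ℝ => A (x, s)) (𝓝[>] 0) (𝓝 (normalVec φ x)) := by
    rw [tendsto_iff_norm_sub_tendsto_zero]
    refine squeeze_zero' (Eventually.of_forall fun _ => norm_nonneg _)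
      (g := fun s : ℝ => L * s) ?_ (by simpa using hs0.const_mul (L : ℝ))
    filter_upwards [self_mem_nhdsWithin] with s hs using hA0 s hs
  have T3 : Tendsto (fun s : ℝ => (ContinuousLinearMap.snd ℝ (Euc d) ℝ).smulRight (A (x, s)))
      (𝓝[>] 0) (𝓝 ((ContinuousLinearMap.snd ℝ (Euc d) ℝ).smulRight (normalVec φ x))) :=
    ((ContinuousLinearMap.smulRightL ℝ (Euc d × ℝ) (Euc d × ℝ)
      (ContinuousLinearMap.snd ℝ (Euc d) ℝ)).continuous.tendsto _).comp T2
  have T := (tendsto_const_nhds (x := (ContinuousLinearMap.fst ℝ (Euc d) ℝ).prod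
          ((fderiv ℝ φ x).comp (ContinuousLinearMap.fst ℝ (Euc d) ℝ)))).sub (T1.add T3)
  rw [zero_add] at T
  refine T.congr' ?_
  filter_upwards [self_mem_nhdsWithin] with s hs using (hform s hs).symm

/-- For `φ` differentiable with Lipschitz gradient,
`F(x,s) = (x,φ(x)) − s (η_s * ν)(x)`, as `s → 0⁺`:
(i) `∂_k F(x,s) → (e_k, ∂_kφ(x))` for each `k`; (ii) `∂_s F(x,s) → −ν(x)`;
and if moreover `φ(0) = 0` and `∇φ(0) = 0`, then `DF(0,s) → Id`. -/
theorem statement_17 (d : ℕ) (φ : Euc d → ℝ) (hφ : Differentiable ℝ φ)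
    (Kgrad : ℝ≥0) (hLip : LipschitzWith Kgrad (gradient φ))
    (C : ℝ) (hC : 0 < C) (hnorm : ∫ x : Euc d, bump d C x = 1) :
    (∀ (x : Euc d) (k : Fin d),
      Tendsto (fun s : ℝ =>
          fderiv ℝ (Fmap C φ) (x, s) ((EuclideanSpace.single k 1 : Euc d), (0 : ℝ)))
        (𝓝[>] 0)
        (𝓝 ((EuclideanSpace.single k 1 : Euc d),
          fderiv ℝ φ x (EuclideanSpace.single k 1)))) ∧
    (∀ x : Euc d,
      Tendsto (fun s : ℝ => fderiv ℝ (Fmap C φ) (x, s) ((0 : Euc d), (1 : ℝ)))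
        (𝓝[>] 0) (𝓝 (-normalVec φ x))) ∧
    (φ 0 = 0 → gradient φ 0 = 0 →
      Tendsto (fun s : ℝ => fderiv ℝ (Fmap C φ) ((0 : Euc d), s)) (𝓝[>] 0)
        (𝓝 (ContinuousLinearMap.id ℝ (Euc d × ℝ)))) := by
  have M := main_tendsto d φ hφ Kgrad hLip C hC hnorm
  have ev : ∀ (x : Euc d) (v : Euc d × ℝ), Tendsto (fun s : ℝ => fderiv ℝ (Fmap C φ) (x, s) v)
      (𝓝[>] 0) (𝓝 (((ContinuousLinearMap.fst ℝ (Euc d) ℝ).prod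
          ((fderiv ℝ φ x).comp (ContinuousLinearMap.fst ℝ (Euc d) ℝ))
        - (ContinuousLinearMap.snd ℝ (Euc d) ℝ).smulRight (normalVec φ x)) v)) := fun x v =>
    ((ContinuousLinearMap.apply ℝ (Euc d × ℝ) v).continuous.tendsto _).comp (M x)
  refine ⟨fun x k => ?_, fun x => ?_, fun _ hg => ?_⟩
  · have h := ev x (EuclideanSpace.single k 1, 0)
    convert h using 2
    simp
  · have h := ev x (0, 1)
    convert h using 2
    simp
    exact (zero_sub _).symm
  · convert M 0 using 2
    have h0 : fderiv ℝ φ 0 = 0 := by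
      have := (hφ 0).hasGradientAt.hasFDerivAt.fderiv
      rw [this, hg, map_zero]
    refine ContinuousLinearMap.ext fun v => ?_
    ext1 <;> simp [h0, hg, normalVec]
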